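/- arXiv:2502.12689 — 7 statements merged into one kernel-verified Lean document; each statement's English description precedes it below -/
import Mathlib

section
/- Let A ∈ ℝ^{n×n} and β ∈ ℝ. Define S₁ = AAᵀ + AᵀA and S_{k+1} = S₁ + β²(A S_k Aᵀ + Aᵀ S_k A) for k ≥ 1. Then for every k ≥ 1, S_k = Σ_{ℓ=1}^{k} Σ_{Ψ: |Ψ|=ℓ} β^{2ℓ−2} Ψ(A) Ψ(A)ᵀ, where the inner sum runs over all 2^ℓ walk patterns of length ℓ. -/
open Matrix

/-- `Ψ(M,N)`: the product `X₁ ⋯ X_ℓ` where `X_k = M` if the `k`-th letter is `d`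
(encoded `true`) and `X_k = N` if it is `r` (encoded `false`).
We write `patMat A Aᵀ` for `Ψ(A) = Ψ(A, Aᵀ)`. -/
def patMat {n : ℕ} (M N : Matrix (Fin n) (Fin n) ℝ) (l : List Bool) :
    Matrix (Fin n) (Fin n) ℝ :=
  (l.map fun b => if b then M else N).prod

/-- The sum of `Ψ(A) Ψ(A)ᵀ` over all walk patterns `Ψ` of length `ℓ`. -/
def patGram {n : ℕ} (A : Matrix (Fin n) (Fin n) ℝ) (ℓ : ℕ) : Matrix (Fin n) (Fin n) ℝ :=
  ∑ f : Fin ℓ → Bool, patMat A Aᵀ (List.ofFn f) * (patMat A Aᵀ (List.ofFn f))ᵀ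

lemma patMat_cons {n : ℕ} (M N : Matrix (Fin n) (Fin n) ℝ) (b : Bool) (l : List Bool) :
    patMat M N (b :: l) = (if b then M else N) * patMat M N l := by
  simp [patMat]

lemma patGram_zero {n : ℕ} (A : Matrix (Fin n) (Fin n) ℝ) : patGram A 0 = 1 := by
  simp [patGram, patMat]

lemma patGram_succ {n : ℕ} (A : Matrix (Fin n) (Fin n) ℝ) (ℓ : ℕ) :
    patGram A (ℓ + 1) = A * patGram A ℓ * Aᵀ + Aᵀ * patGram A ℓ * A := by
  unfold patGram
  rw [← (Fin.consEquiv fun _ : Fin (ℓ + 1) => Bool).sum_comp, Fintype.sum_prod_type,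
    Fintype.sum_bool]
  simp [Fin.consEquiv, List.ofFn_succ, patMat_cons, Finset.mul_sum, Finset.sum_mul,
    Matrix.transpose_mul, Matrix.mul_assoc]

lemma partial_sums_eq_sum_patGram {n : ℕ} (A : Matrix (Fin n) (Fin n) ℝ) (β : ℝ)
    (S : ℕ → Matrix (Fin n) (Fin n) ℝ)
    (hS1 : S 1 = A * Aᵀ + Aᵀ * A)
    (hSrec : ∀ k ≥ 1, S (k + 1) = S 1 + β ^ 2 • (A * S k * Aᵀ + Aᵀ * S k * A))
    (k : ℕ) (hk : 1 ≤ k) :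
    S k = ∑ i ∈ Finset.range k, β ^ (2 * i) • patGram A (i + 1) := by
  have hone : S 1 = patGram A 1 := by simp [hS1, patGram_succ A 0, patGram_zero]
  induction k, hk using Nat.le_induction with
  | base => simp [hone]
  | succ k hk ih =>
    rw [hSrec k hk, ih, Finset.sum_range_succ', hone, add_comm]
    congr 1
    · simp only [Finset.mul_sum, Finset.sum_mul, ← Finset.sum_add_distrib, Finset.smul_sum]
      refine Finset.sum_congr rfl fun i _ => ?_
      rw [patGram_succ A (i + 1), Matrix.mul_smul, Matrix.smul_mul, Matrix.mul_smul,
        Matrix.smul_mul, ← smul_add, smul_smul]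
      congr 1
      ring
    · simp

/-- Theorem: with `S₁ = AAᵀ + AᵀA` and `S_{k+1} = S₁ + β²(A S_k Aᵀ + Aᵀ S_k A)`
for `k ≥ 1`, one has `S_k = Σ_{ℓ=1}^{k} Σ_{|Ψ|=ℓ} β^{2ℓ−2} Ψ(A) Ψ(A)ᵀ`, the
inner sum running over all `2^ℓ` walk patterns of length `ℓ` (encoded as
functions `Fin ℓ → Bool`). -/
theorem partial_sums_recurrence {n : ℕ} (A : Matrix (Fin n) (Fin n) ℝ) (β : ℝ)
    (S : ℕ → Matrix (Fin n) (Fin n) ℝ)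
    (hS1 : S 1 = A * Aᵀ + Aᵀ * A)
    (hSrec : ∀ k ≥ 1, S (k + 1) = S 1 + β ^ 2 • (A * S k * Aᵀ + Aᵀ * S k * A)) :
    ∀ k ≥ 1, S k = ∑ ℓ ∈ Finset.Icc 1 k, ∑ f : Fin ℓ → Bool,
      β ^ (2 * ℓ - 2) •
        (patMat A Aᵀ (List.ofFn f) * (patMat A Aᵀ (List.ofFn f))ᵀ) := by
  intro k hk
  rw [partial_sums_eq_sum_patGram A β S hS1 hSrec k hk, ← Finset.Ico_add_one_right_eq_Icc,
    Finset.sum_Ico_eq_sum_range]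
  refine Finset.sum_congr rfl fun i _ => ?_
  rw [add_comm 1 i, ← Finset.smul_sum, patGram]
  congr 1
end

section
/- Let A ∈ ℝ^{n×n} be an entrywise nonnegative irreducible matrix with all row sums and all column sums positive. Let P = D_out^{−1}A and Q = D_in^{−1}Aᵀ, where D_out and D_in are the diagonal matrices of row sums of A and of Aᵀ, respectively. Let β ≥ 0. Then the series Σ_{ℓ=1}^{∞} β^{2ℓ−2} S^(ℓ), where S^(ℓ) = 2^{−ℓ} Σ_{Ψ: |Ψ|=ℓ} Ψ(P,Q) Ψ(P,Q)ᵀ, converges (i.e., its partial sums converge in ℝ^{n×n}) if and only if β² < 1. -/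
open Matrix Filter

/-- `S^(ℓ) = 2^{−ℓ} Σ_{|Ψ|=ℓ} Ψ(P,Q) Ψ(P,Q)ᵀ`, the sum running over all `2^ℓ`
walk patterns of length `ℓ` (encoded as functions `Fin ℓ → Bool`). -/
noncomputable def Sl {n : ℕ} (P Q : Matrix (Fin n) (Fin n) ℝ) (ℓ : ℕ) :
    Matrix (Fin n) (Fin n) ℝ :=
  ((2 : ℝ) ^ ℓ)⁻¹ •
    ∑ f : Fin ℓ → Bool, patMat P Q (List.ofFn f) * (patMat P Q (List.ofFn f))ᵀ

/-- Row-stochastic normalization `D⁻¹ A` of a matrix `A`, where `D` is the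
diagonal matrix of the row sums of `A`. -/
noncomputable def rowNormalize {n : ℕ} (A : Matrix (Fin n) (Fin n) ℝ) :
    Matrix (Fin n) (Fin n) ℝ :=
  Matrix.diagonal (fun i => (∑ j, A i j)⁻¹) * A

/-- A square nonnegative matrix is irreducible if for every pair `(i,j)` there
is `m ≥ 1` with `(A^m)_{ij} > 0`. -/
def IsIrreducibleMat {m : Type*} [Fintype m] [DecidableEq m]
    (A : Matrix m m ℝ) : Prop :=
  ∀ i j, ∃ k ≥ 1, 0 < (A ^ k) i j

theorem rowNormalize_mem_rowStochastic {n : ℕ} {A : Matrix (Fin n) (Fin n) ℝ}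
    (hA : ∀ i j, 0 ≤ A i j) (hrow : ∀ i, 0 < ∑ j, A i j) :
    rowNormalize A ∈ rowStochastic ℝ (Fin n) := by
  rw [mem_rowStochastic_iff_sum]
  refine ⟨fun i j => ?_, fun i => ?_⟩
  · rw [rowNormalize, diagonal_mul]
    exact mul_nonneg (inv_nonneg.2 (hrow i).le) (hA i j)
  · simp only [rowNormalize, diagonal_mul]
    rw [← Finset.mul_sum, inv_mul_cancel₀ (hrow i).ne']

theorem patMat_mem_rowStochastic {n : ℕ} {M N : Matrix (Fin n) (Fin n) ℝ}
    (hM : M ∈ rowStochastic ℝ (Fin n)) (hN : N ∈ rowStochastic ℝ (Fin n)) (l : List Bool) :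
    patMat M N l ∈ rowStochastic ℝ (Fin n) := by
  refine Submonoid.list_prod_mem _ fun X hX => ?_
  obtain ⟨b, -, rfl⟩ := List.mem_map.1 hX
  cases b <;> simpa

theorem Sl_apply {n : ℕ} (P Q : Matrix (Fin n) (Fin n) ℝ) (ℓ : ℕ) (i j : Fin n) :
    Sl P Q ℓ i j = ((2 : ℝ) ^ ℓ)⁻¹ * ∑ f : Fin ℓ → Bool,
      ∑ k, patMat P Q (List.ofFn f) i k * patMat P Q (List.ofFn f) j k := by
  simp [Sl, Matrix.sum_apply, Matrix.mul_apply]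

theorem Sl_apply_nonneg {n : ℕ} {P Q : Matrix (Fin n) (Fin n) ℝ}
    (hP : P ∈ rowStochastic ℝ (Fin n)) (hQ : Q ∈ rowStochastic ℝ (Fin n))
    (ℓ : ℕ) (i j : Fin n) : 0 ≤ Sl P Q ℓ i j := by
  rw [Sl_apply]
  have h (f : Fin ℓ → Bool) :=
    (mem_rowStochastic_iff_sum.1 (patMat_mem_rowStochastic hP hQ (List.ofFn f))).1
  exact mul_nonneg (by positivity) <| Finset.sum_nonneg fun f _ => Finset.sum_nonneg fun k _ =>
    mul_nonneg (h f i k) (h f j k)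

theorem Sl_apply_le_one {n : ℕ} {P Q : Matrix (Fin n) (Fin n) ℝ}
    (hP : P ∈ rowStochastic ℝ (Fin n)) (hQ : Q ∈ rowStochastic ℝ (Fin n))
    (ℓ : ℕ) (i j : Fin n) : Sl P Q ℓ i j ≤ 1 := by
  rw [Sl_apply, inv_mul_le_one₀ (by positivity)]
  calc _ ≤ ∑ _f : Fin ℓ → Bool, (1 : ℝ) := by
        refine Finset.sum_le_sum fun f _ => ?_
        have h := patMat_mem_rowStochastic hP hQ (List.ofFn f)
        rw [← sum_row_of_mem_rowStochastic h i]
        exact Finset.sum_le_sum fun k _ => mul_le_of_le_one_right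
          (nonneg_of_mem_rowStochastic h) (le_one_of_mem_rowStochastic h)
    _ = 2 ^ ℓ := by simp

theorem one_div_le_Sl_apply_self {n : ℕ} {P Q : Matrix (Fin n) (Fin n) ℝ}
    (hP : P ∈ rowStochastic ℝ (Fin n)) (hQ : Q ∈ rowStochastic ℝ (Fin n))
    (ℓ : ℕ) (i : Fin n) : 1 / (n : ℝ) ≤ Sl P Q ℓ i i := by
  have hn : (0 : ℝ) < n := Nat.cast_pos.2 (Fin.pos i)
  rw [Sl_apply, le_inv_mul_iff₀ (by positivity)]
  calc (2 : ℝ) ^ ℓ * (1 / n) = ∑ _f : Fin ℓ → Bool, 1 / (n : ℝ) := by simp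
    _ ≤ _ := by
        refine Finset.sum_le_sum fun f _ => ?_
        have h1 := (mem_rowStochastic_iff_sum.1
          (patMat_mem_rowStochastic hP hQ (List.ofFn f))).2 i
        have h := sq_sum_le_card_mul_sum_sq (s := Finset.univ)
          (f := fun k => patMat P Q (List.ofFn f) i k)
        rw [h1, Finset.card_univ, Fintype.card_fin, one_pow] at h
        rw [div_le_iff₀' hn]
        simpa only [← sq] using h

/-- Theorem: with `P = D_out⁻¹ A`, `Q = D_in⁻¹ Aᵀ` for a nonnegative
irreducible `A` with positive row and column sums, and `β ≥ 0`, the series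
`Σ_{ℓ≥1} β^{2ℓ−2} S^(ℓ)` converges (its partial sums converge) iff `β² < 1`. -/
theorem series_converges_iff {n : ℕ} (hn : 0 < n) (A : Matrix (Fin n) (Fin n) ℝ)
    (hA : ∀ i j, 0 ≤ A i j) (hirr : IsIrreducibleMat A)
    (hrow : ∀ i, 0 < ∑ j, A i j) (hcol : ∀ j, 0 < ∑ i, A i j)
    (β : ℝ) (hβ0 : 0 ≤ β)
    (P Q : Matrix (Fin n) (Fin n) ℝ)
    (hP : P = rowNormalize A) (hQ : Q = rowNormalize Aᵀ) :
    (∃ L : Matrix (Fin n) (Fin n) ℝ,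
      Tendsto (fun k => ∑ ℓ ∈ Finset.Icc 1 k, β ^ (2 * ℓ - 2) • Sl P Q ℓ)
        atTop (nhds L)) ↔ β ^ 2 < 1 := by
  have hPs : P ∈ rowStochastic ℝ (Fin n) := hP ▸ rowNormalize_mem_rowStochastic hA hrow
  have hQs : Q ∈ rowStochastic ℝ (Fin n) :=
    hQ ▸ rowNormalize_mem_rowStochastic (fun i j => hA j i) hcol
  have hsum (k : ℕ) : ∑ ℓ ∈ Finset.Icc 1 k, β ^ (2 * ℓ - 2) • Sl P Q ℓ =
      ∑ m ∈ Finset.range k, (β ^ 2) ^ m • Sl P Q (m + 1) := by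
    induction k with
    | zero => simp
    | succ k ih =>
      rw [Finset.sum_Icc_succ_top (by omega), ih, Finset.sum_range_succ, ← pow_mul]
      rfl
  simp only [hsum]
  constructor
  · rintro ⟨L, hL⟩
    by_contra! hβ
    let i : Fin n := ⟨0, hn⟩
    have hterm : Tendsto (fun k => ((β ^ 2) ^ k • Sl P Q (k + 1)) i i) atTop (nhds 0) := by
      have h := tendsto_pi_nhds.1 (tendsto_pi_nhds.1
        ((hL.comp (tendsto_add_atTop_nat 1)).sub hL) i) i
      simpa [Finset.sum_range_succ] using h
    have hle : 1 / (n : ℝ) ≤ 0 := ge_of_tendsto' hterm fun k =>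
      (one_div_le_Sl_apply_self hPs hQs (k + 1) i).trans <|
        le_mul_of_one_le_left (Sl_apply_nonneg hPs hQs _ i i) (one_le_pow₀ hβ)
    have : 0 < 1 / (n : ℝ) := by positivity
    linarith
  · intro hβ
    have hs (i j : Fin n) : Summable fun m => (β ^ 2) ^ m * Sl P Q (m + 1) i j :=
      Summable.of_nonneg_of_le
        (fun m => mul_nonneg (by positivity) (Sl_apply_nonneg hPs hQs _ i j))
        (fun m => mul_le_of_le_one_right (by positivity) (Sl_apply_le_one hPs hQs _ i j))
        (summable_geometric_of_lt_one (sq_nonneg β) hβ)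
    refine ⟨fun i j => ∑' m, (β ^ 2) ^ m * Sl P Q (m + 1) i j,
      tendsto_pi_nhds.2 fun i => tendsto_pi_nhds.2 fun j => ?_⟩
    simpa [Matrix.sum_apply] using (hs i j).hasSum.tendsto_sum_nat
end

section
/- Let P, Q ∈ ℝ^{n×n} be row-stochastic matrices and let 0 ≤ β² < 1. Then for every C ∈ ℝ^{n×n} the matrix equation S − (β²/2)(P S Pᵀ + Q S Qᵀ) = C has a unique solution S ∈ ℝ^{n×n}. Moreover, the matrix S* = Σ_{ℓ=1}^{∞} β^{2ℓ−2} S^(ℓ), with S^(ℓ) = 2^{−ℓ} Σ_{Ψ: |Ψ|=ℓ} Ψ(P,Q) Ψ(P,Q)ᵀ, is (whenever this series converges) the unique solution of this equation with right-hand side C = (1/2)(PPᵀ + QQᵀ). -/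
open Matrix Filter

/-- A matrix is row stochastic if all its entries are nonnegative and every
row sums to 1. -/
def RowStochastic {n : ℕ} (P : Matrix (Fin n) (Fin n) ℝ) : Prop :=
  (∀ i j, 0 ≤ P i j) ∧ ∀ i, ∑ j, P i j = 1

/-- The linear operator `S ↦ (1/2)(P S Pᵀ + Q S Qᵀ)`. -/
noncomputable def avgConj {n : ℕ} (P Q : Matrix (Fin n) (Fin n) ℝ) :
    Matrix (Fin n) (Fin n) ℝ →ₗ[ℝ] Matrix (Fin n) (Fin n) ℝ where
  toFun S := (1 / 2 : ℝ) • (P * S * Pᵀ + Q * S * Qᵀ)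
  map_add' S T := by
    rw [← smul_add]
    congr 1
    noncomm_ring
  map_smul' c S := by
    simp only [Matrix.mul_smul, Matrix.smul_mul, ← smul_add, RingHom.id_apply]
    rw [smul_comm]

theorem avgConj_apply {n : ℕ} (P Q S : Matrix (Fin n) (Fin n) ℝ) :
    avgConj P Q S = (1 / 2 : ℝ) • (P * S * Pᵀ + Q * S * Qᵀ) := rfl

theorem half_smul_conj_eq {n : ℕ} (P Q S : Matrix (Fin n) (Fin n) ℝ) (c : ℝ) :
    (c / 2) • (P * S * Pᵀ + Q * S * Qᵀ) = c • avgConj P Q S := by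
  rw [avgConj_apply, smul_smul, mul_one_div]

theorem continuous_avgConj {n : ℕ} (P Q : Matrix (Fin n) (Fin n) ℝ) :
    Continuous (avgConj P Q) := by
  change Continuous fun S => (1 / 2 : ℝ) • (P * S * Pᵀ + Q * S * Qᵀ)
  fun_prop

theorem Sl_zero {n : ℕ} (P Q : Matrix (Fin n) (Fin n) ℝ) : Sl P Q 0 = 1 := by
  simp [Sl, patMat]

theorem Sl_succ {n : ℕ} (P Q : Matrix (Fin n) (Fin n) ℝ) (ℓ : ℕ) :
    Sl P Q (ℓ + 1) = avgConj P Q (Sl P Q ℓ) := by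
  have hsplit (X : Matrix (Fin n) (Fin n) ℝ) :
      X * (∑ f : Fin ℓ → Bool, patMat P Q (List.ofFn f) * (patMat P Q (List.ofFn f))ᵀ) * Xᵀ =
        ∑ f : Fin ℓ → Bool,
          X * patMat P Q (List.ofFn f) * (X * patMat P Q (List.ofFn f))ᵀ := by
    simp only [Finset.mul_sum, Finset.sum_mul, Matrix.transpose_mul, Matrix.mul_assoc]
  rw [Sl, Sl, map_smul, avgConj_apply, hsplit, hsplit, smul_smul,
    ← (Fin.consEquiv fun _ => Bool).sum_comp, Fintype.sum_prod_type]
  congr 1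
  · rw [pow_succ, mul_inv, one_div]
  · simp [Fin.consEquiv, patMat]

/-- Conjugation by a row-stochastic matrix does not increase the largest entry. -/
theorem RowStochastic.abs_conj_le {n : ℕ} {P S : Matrix (Fin n) (Fin n) ℝ}
    (hP : RowStochastic P) {m : ℝ} (hS : ∀ i j, |S i j| ≤ m) (i j : Fin n) :
    |(P * S * Pᵀ) i j| ≤ m := by
  have hleft (a b : Fin n) : |(P * S) a b| ≤ m := by
    rw [Matrix.mul_apply]
    calc |∑ k, P a k * S k b| ≤ ∑ k, |P a k * S k b| := Finset.abs_sum_le_sum_abs _ _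
      _ ≤ ∑ k, P a k * m := by
        gcongr with k
        rw [abs_mul, abs_of_nonneg (hP.1 a k)]
        exact mul_le_mul_of_nonneg_left (hS k b) (hP.1 a k)
      _ = m := by rw [← Finset.sum_mul, hP.2, one_mul]
  rw [Matrix.mul_apply]
  calc |∑ k, (P * S) i k * Pᵀ k j| ≤ ∑ k, |(P * S) i k * Pᵀ k j| :=
        Finset.abs_sum_le_sum_abs _ _
    _ ≤ ∑ k, m * P j k := by
      gcongr with k
      rw [abs_mul, Matrix.transpose_apply, abs_of_nonneg (hP.1 j k)]
      exact mul_le_mul_of_nonneg_right (hleft i k) (hP.1 j k)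
    _ = m := by rw [← Finset.mul_sum, hP.2, mul_one]

theorem abs_avgConj_le {n : ℕ} {P Q S : Matrix (Fin n) (Fin n) ℝ}
    (hP : RowStochastic P) (hQ : RowStochastic Q) {m : ℝ} (hS : ∀ i j, |S i j| ≤ m)
    (i j : Fin n) : |avgConj P Q S i j| ≤ m := by
  have hp := abs_le.mp (hP.abs_conj_le hS i j)
  have hq := abs_le.mp (hQ.abs_conj_le hS i j)
  rw [avgConj_apply, Matrix.smul_apply, Matrix.add_apply, smul_eq_mul, abs_le]
  constructor <;> linarith

theorem eq_zero_of_eq_smul_avgConj {n : ℕ} {P Q S : Matrix (Fin n) (Fin n) ℝ}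
    (hP : RowStochastic P) (hQ : RowStochastic Q) {c : ℝ} (hc₀ : 0 ≤ c) (hc₁ : c < 1)
    (hS : S = c • avgConj P Q S) : S = 0 := by
  rcases isEmpty_or_nonempty (Fin n) with _ | _
  · exact Subsingleton.elim _ _
  obtain ⟨p, hp⟩ := Finite.exists_max fun p : Fin n × Fin n => |S p.1 p.2|
  have hbound := abs_avgConj_le hP hQ (fun i j => hp (i, j)) p.1 p.2
  have hentry : |S p.1 p.2| = c * |avgConj P Q S p.1 p.2| := by
    conv_lhs => rw [hS]
    rw [Matrix.smul_apply, smul_eq_mul, abs_mul, abs_of_nonneg hc₀]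
  have hmax : |S p.1 p.2| ≤ 0 := by
    nlinarith [abs_nonneg (S p.1 p.2), mul_le_mul_of_nonneg_left hbound hc₀]
  ext i j
  exact abs_nonpos_iff.mp ((hp (i, j)).trans hmax)

theorem sum_Sl_succ {n : ℕ} (P Q : Matrix (Fin n) (Fin n) ℝ) (β : ℝ) (k : ℕ) :
    ∑ ℓ ∈ Finset.Icc 1 (k + 1), β ^ (2 * ℓ - 2) • Sl P Q ℓ =
      avgConj P Q 1 +
        β ^ 2 • avgConj P Q (∑ ℓ ∈ Finset.Icc 1 k, β ^ (2 * ℓ - 2) • Sl P Q ℓ) := by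
  induction k with
  | zero => simp [Sl_succ, Sl_zero]
  | succ k ih =>
    rw [Finset.sum_Icc_succ_top (show 1 ≤ k + 1 + 1 by omega)]
    conv_lhs => rw [ih]
    rw [Finset.sum_Icc_succ_top (show 1 ≤ k + 1 by omega), map_add, smul_add, ← add_assoc,
      map_smul, smul_smul, ← pow_add, Sl_succ P Q (k + 1)]
    congr 3
    omega

/-- Theorem: for row-stochastic `P, Q` and `0 ≤ β² < 1`, the equation
`S − (β²/2)(P S Pᵀ + Q S Qᵀ) = C` has a unique solution for every `C`;
moreover, whenever the series `S* = Σ_{ℓ≥1} β^{2ℓ−2} S^(ℓ)` converges, its sum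
solves the equation with `C = (1/2)(PPᵀ + QQᵀ)`. -/
theorem unique_solution_and_series_solves {n : ℕ}
    (P Q : Matrix (Fin n) (Fin n) ℝ)
    (hP : RowStochastic P) (hQ : RowStochastic Q)
    (β : ℝ) (hβ : β ^ 2 < 1) :
    (∀ C : Matrix (Fin n) (Fin n) ℝ,
      ∃! S : Matrix (Fin n) (Fin n) ℝ,
        S - (β ^ 2 / 2) • (P * S * Pᵀ + Q * S * Qᵀ) = C) ∧
    (∀ Sstar : Matrix (Fin n) (Fin n) ℝ,
      Tendsto (fun k => ∑ ℓ ∈ Finset.Icc 1 k, β ^ (2 * ℓ - 2) • Sl P Q ℓ)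
        atTop (nhds Sstar) →
      Sstar - (β ^ 2 / 2) • (P * Sstar * Pᵀ + Q * Sstar * Qᵀ) =
        (1 / 2 : ℝ) • (P * Pᵀ + Q * Qᵀ)) := by
  simp only [half_smul_conj_eq]
  constructor
  · let T := LinearMap.id - β ^ 2 • avgConj P Q
    have hinj : Function.Injective T := by
      rw [injective_iff_map_eq_zero]
      intro S hS
      exact eq_zero_of_eq_smul_avgConj hP hQ (sq_nonneg β) hβ (sub_eq_zero.mp hS)
    exact Function.Bijective.existsUnique ⟨hinj, LinearMap.injective_iff_surjective.mp hinj⟩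
  · intro Sstar hlim
    have hshift := hlim.comp (tendsto_add_atTop_nat 1)
    have hstep := (((continuous_avgConj P Q).tendsto Sstar).comp hlim).const_smul (β ^ 2)
      |>.const_add (avgConj P Q 1)
    have hfix : Sstar = avgConj P Q 1 + β ^ 2 • avgConj P Q Sstar :=
      tendsto_nhds_unique hshift (hstep.congr fun k => (sum_Sl_succ P Q β k).symm)
    rw [sub_eq_of_eq_add hfix, avgConj_apply, Matrix.mul_one, Matrix.mul_one]
end

section
/- Let P, Q ∈ ℝ^{n×n} be row-stochastic matrices, let 0 ≤ β² < 1, and let S̄ be the unique solution of the matrix equation S − (β²/2)(P S Pᵀ + Q S Qᵀ) = PPᵀ + QQᵀ. Then the iteration Z_k = P(I + (β²/2) Z_{k−1})Pᵀ + Q(I + (β²/2) Z_{k−1})Qᵀ satisfies ‖Z_k − S̄‖_max ≤ β² ‖Z_{k−1} − S̄‖_max for every k ≥ 1 and every initial matrix Z₀ ∈ ℝ^{n×n}; in particular, the iteration converges to S̄ from any starting matrix. -/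
open Matrix Filter

/-- The max-norm `‖X‖_max = max_{i,j} |X_{ij}|` of a real matrix. -/
noncomputable def maxNorm {n : ℕ} (X : Matrix (Fin n) (Fin n) ℝ) : ℝ :=
  sSup (Set.range fun p : Fin n × Fin n => |X p.1 p.2|)

lemma abs_le_maxNorm {n : ℕ} (X : Matrix (Fin n) (Fin n) ℝ) (i j : Fin n) :
    |X i j| ≤ maxNorm X :=
  le_csSup (Set.finite_range fun p : Fin n × Fin n => |X p.1 p.2|).bddAbove ⟨(i, j), rfl⟩

lemma maxNorm_nonneg {n : ℕ} (X : Matrix (Fin n) (Fin n) ℝ) : 0 ≤ maxNorm X :=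
  Real.sSup_nonneg <| by
    rintro _ ⟨p, rfl⟩
    exact abs_nonneg _

lemma maxNorm_le {n : ℕ} {X : Matrix (Fin n) (Fin n) ℝ} {c : ℝ} (hc : 0 ≤ c)
    (h : ∀ i j, |X i j| ≤ c) : maxNorm X ≤ c :=
  Real.sSup_le (by rintro _ ⟨p, rfl⟩; exact h p.1 p.2) hc

/-- Averaging bounded numbers with the weights of a stochastic row keeps the bound. -/
lemma RowStochastic.abs_sum_mul_le {n : ℕ} {P : Matrix (Fin n) (Fin n) ℝ}
    (hP : RowStochastic P) (i : Fin n) {f : Fin n → ℝ} {c : ℝ} (h : ∀ j, |f j| ≤ c) :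
    |∑ j, P i j * f j| ≤ c :=
  calc |∑ j, P i j * f j| ≤ ∑ j, |P i j * f j| := Finset.abs_sum_le_sum_abs _ _
    _ ≤ ∑ j, P i j * c := Finset.sum_le_sum fun j _ => by
        rw [abs_mul, abs_of_nonneg (hP.1 i j)]
        exact mul_le_mul_of_nonneg_left (h j) (hP.1 i j)
    _ = c := by rw [← Finset.sum_mul, hP.2 i, one_mul]

lemma RowStochastic.abs_mul_mul_transpose_le {n : ℕ} {P : Matrix (Fin n) (Fin n) ℝ}
    (hP : RowStochastic P) (X : Matrix (Fin n) (Fin n) ℝ) (i j : Fin n) :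
    |(P * X * Pᵀ) i j| ≤ maxNorm X := by
  rw [Matrix.mul_assoc, Matrix.mul_apply]
  refine hP.abs_sum_mul_le i fun k => ?_
  simp_rw [Matrix.mul_apply, Matrix.transpose_apply, mul_comm (X k _)]
  exact hP.abs_sum_mul_le j fun l => abs_le_maxNorm X k l

lemma maxNorm_smul_add_le {n : ℕ} {P Q : Matrix (Fin n) (Fin n) ℝ}
    (hP : RowStochastic P) (hQ : RowStochastic Q) (β : ℝ) (X : Matrix (Fin n) (Fin n) ℝ) :
    maxNorm ((β ^ 2 / 2) • (P * X * Pᵀ + Q * X * Qᵀ)) ≤ β ^ 2 * maxNorm X := by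
  refine maxNorm_le (mul_nonneg (sq_nonneg β) (maxNorm_nonneg X)) fun i j => ?_
  rw [Matrix.smul_apply, Matrix.add_apply, smul_eq_mul, abs_mul,
    abs_of_nonneg (by positivity : 0 ≤ β ^ 2 / 2)]
  calc β ^ 2 / 2 * |(P * X * Pᵀ) i j + (Q * X * Qᵀ) i j|
      ≤ β ^ 2 / 2 * (maxNorm X + maxNorm X) := by
        gcongr
        exact (abs_add_le _ _).trans
          (add_le_add (hP.abs_mul_mul_transpose_le X i j) (hQ.abs_mul_mul_transpose_le X i j))
    _ = β ^ 2 * maxNorm X := by ring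

lemma tendsto_of_maxNorm_sub_tendsto_zero {n : ℕ} {Z : ℕ → Matrix (Fin n) (Fin n) ℝ}
    {S : Matrix (Fin n) (Fin n) ℝ} (h : Tendsto (fun k => maxNorm (Z k - S)) atTop (nhds 0)) :
    Tendsto Z atTop (nhds S) := by
  refine tendsto_pi_nhds.2 fun i => tendsto_pi_nhds.2 fun j => ?_
  rw [tendsto_iff_dist_tendsto_zero]
  exact squeeze_zero (fun _ => dist_nonneg) (fun k => abs_le_maxNorm (Z k - S) i j) h

/-- Theorem: for row-stochastic `P, Q`, `0 ≤ β² < 1` and `S̄` the solution of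
`S − (β²/2)(P S Pᵀ + Q S Qᵀ) = PPᵀ + QQᵀ`, the iteration
`Z_k = P(I + (β²/2) Z_{k−1})Pᵀ + Q(I + (β²/2) Z_{k−1})Qᵀ` contracts in the
max-norm with factor `β²` and converges to `S̄` from any starting matrix. -/
theorem iteration_contracts_and_converges {n : ℕ}
    (P Q : Matrix (Fin n) (Fin n) ℝ)
    (hP : RowStochastic P) (hQ : RowStochastic Q)
    (β : ℝ) (hβ : β ^ 2 < 1)
    (Sbar : Matrix (Fin n) (Fin n) ℝ)
    (hSbar : Sbar - (β ^ 2 / 2) • (P * Sbar * Pᵀ + Q * Sbar * Qᵀ) =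
      P * Pᵀ + Q * Qᵀ)
    (Z : ℕ → Matrix (Fin n) (Fin n) ℝ)
    (hZ : ∀ k ≥ 1, Z k = P * (1 + (β ^ 2 / 2) • Z (k - 1)) * Pᵀ +
      Q * (1 + (β ^ 2 / 2) • Z (k - 1)) * Qᵀ) :
    (∀ k ≥ 1, maxNorm (Z k - Sbar) ≤ β ^ 2 * maxNorm (Z (k - 1) - Sbar)) ∧
    Tendsto Z atTop (nhds Sbar) := by
  have contracts : ∀ k ≥ 1, maxNorm (Z k - Sbar) ≤ β ^ 2 * maxNorm (Z (k - 1) - Sbar) := by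
    intro k hk
    have hdiff : Z k - Sbar = (β ^ 2 / 2) •
        (P * (Z (k - 1) - Sbar) * Pᵀ + Q * (Z (k - 1) - Sbar) * Qᵀ) := by
      have hfix := sub_eq_iff_eq_add.1 hSbar
      rw [sub_eq_iff_eq_add, hZ k hk]
      conv_rhs => rw [add_comm]; arg 1; rw [hfix]
      simp only [Matrix.mul_add, Matrix.add_mul, Matrix.mul_sub, Matrix.sub_mul, Matrix.mul_one,
        Matrix.mul_smul, Matrix.smul_mul, smul_add, smul_sub]
      abel
    rw [hdiff]
    exact maxNorm_smul_add_le hP hQ β _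
  refine ⟨contracts, tendsto_of_maxNorm_sub_tendsto_zero ?_⟩
  have geometric : ∀ k, maxNorm (Z k - Sbar) ≤ (β ^ 2) ^ k * maxNorm (Z 0 - Sbar) := by
    intro k
    induction k with
    | zero => simp
    | succ k ih =>
      calc maxNorm (Z (k + 1) - Sbar) ≤ β ^ 2 * maxNorm (Z k - Sbar) :=
            contracts (k + 1) (Nat.le_add_left 1 k)
        _ ≤ β ^ 2 * ((β ^ 2) ^ k * maxNorm (Z 0 - Sbar)) :=
            mul_le_mul_of_nonneg_left ih (sq_nonneg β)
        _ = (β ^ 2) ^ (k + 1) * maxNorm (Z 0 - Sbar) := by ring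
  refine squeeze_zero (fun _ => maxNorm_nonneg _) geometric ?_
  simpa using (tendsto_pow_atTop_nhds_zero_of_lt_one (sq_nonneg β) hβ).mul_const
    (maxNorm (Z 0 - Sbar))
end

section
/- Let P, Q ∈ ℝ^{n×n} be row-stochastic matrices such that the matrix M = (P⊗P + Q⊗Q)/2 ∈ ℝ^{n²×n²} is irreducible. Let W ∈ ℝ^{n×n} be the (unique) entrywise positive solution of (1/2)(Pᵀ W P + Qᵀ W Q) = W normalized so that Σ_{i,j} W_{ij} = 1. For 0 ≤ β² < 1 let S(β) denote the unique solution of S − (β²/2)(P S Pᵀ + Q S Qᵀ) = PPᵀ + QQᵀ. Then lim_{β²→1⁻} (1 − β²) S(β) = 2·trace(W)·𝟏𝟏ᵀ, where 𝟏 ∈ ℝ^n is the all-ones vector. -/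
open Matrix Kronecker Filter

theorem norm_mulVec_le_of_mem_rowStochastic {m : Type*} [Fintype m] [DecidableEq m]
    {M : Matrix m m ℝ} (hM : M ∈ rowStochastic ℝ m) (v : m → ℝ) : ‖M *ᵥ v‖ ≤ ‖v‖ := by
  refine (pi_norm_le_iff_of_nonneg (norm_nonneg v)).2 fun i => ?_
  calc ‖(M *ᵥ v) i‖ ≤ ∑ j, ‖M i j * v j‖ := norm_sum_le _ _
    _ ≤ ∑ j, M i j * ‖v‖ := by
      refine Finset.sum_le_sum fun j _ => ?_
      rw [norm_mul, Real.norm_of_nonneg (nonneg_of_mem_rowStochastic hM)]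
      exact mul_le_mul_of_nonneg_left (norm_le_pi_norm v j) (nonneg_of_mem_rowStochastic hM)
    _ = ‖v‖ := by rw [← Finset.sum_mul, sum_row_of_mem_rowStochastic hM, one_mul]

/-- A harmonic vector of an irreducible row stochastic matrix is constant. -/
theorem eq_of_mulVec_eq_self_of_irreducible {m : Type*} [Fintype m] [DecidableEq m]
    {M : Matrix m m ℝ} (hM : M ∈ rowStochastic ℝ m) (hirr : IsIrreducibleMat M)
    {v : m → ℝ} (hv : M *ᵥ v = v) (i j : m) : v i = v j := by
  have hpow : ∀ k : ℕ, (M ^ k) *ᵥ v = v := fun k => by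
    induction k with
    | zero => simp
    | succ k ih => rw [pow_succ, ← mulVec_mulVec, hv, ih]
  have : Nonempty m := ⟨i⟩
  obtain ⟨a, ha⟩ := Finite.exists_max v
  have key : ∀ j, v a = v j := fun j => by
    obtain ⟨k, -, hk⟩ := hirr a j
    have hMk : M ^ k ∈ rowStochastic ℝ m := pow_mem hM k
    have hsum : ∑ l, (M ^ k) a l * (v a - v l) = 0 := by
      simp only [mul_sub, Finset.sum_sub_distrib]
      rw [← Finset.sum_mul, sum_row_of_mem_rowStochastic hMk, one_mul, sub_eq_zero]
      exact (congrFun (hpow k) a).symm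
    have hzero := (Finset.sum_eq_zero_iff_of_nonneg fun l _ =>
      mul_nonneg (nonneg_of_mem_rowStochastic hMk) (sub_nonneg.2 (ha l))).1 hsum j
      (Finset.mem_univ j)
    exact sub_eq_zero.1 ((mul_eq_zero.1 hzero).resolve_left hk.ne')
  rw [← key i, ← key j]

/-- The Poisson equation of an irreducible row stochastic matrix is solvable. -/
theorem exists_sub_mulVec_eq_of_irreducible {m : Type*} [Fintype m] [DecidableEq m]
    {M : Matrix m m ℝ} (hM : M ∈ rowStochastic ℝ m) (hirr : IsIrreducibleMat M)
    {w : m → ℝ} (hw : w ᵥ* M = w) (hw1 : w ⬝ᵥ 1 = 1) (c : m → ℝ) :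
    ∃ u, u - M *ᵥ u = c - (w ⬝ᵥ c) • (1 : m → ℝ) := by
  have hwM : ∀ v, w ⬝ᵥ (M *ᵥ v) = w ⬝ᵥ v := fun v => by rw [dotProduct_mulVec, hw]
  let L : (m → ℝ) →ₗ[ℝ] (m → ℝ) :=
    { toFun := fun v => v - M *ᵥ v + (w ⬝ᵥ v) • (1 : m → ℝ)
      map_add' := fun x y => by
        simp only [mulVec_add, dotProduct_add, add_smul]
        abel
      map_smul' := fun a x => by
        simp only [mulVec_smul, dotProduct_smul, smul_assoc, RingHom.id_apply, smul_add,
          smul_sub] }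
  have hwL : ∀ v, w ⬝ᵥ L v = w ⬝ᵥ v := fun v => by
    change w ⬝ᵥ (v - M *ᵥ v + (w ⬝ᵥ v) • (1 : m → ℝ)) = _
    rw [dotProduct_add, dotProduct_sub, dotProduct_smul, hwM, hw1]
    simp
  have hinj : Function.Injective L := by
    refine (injective_iff_map_eq_zero L).2 fun v hv => ?_
    have hwv : w ⬝ᵥ v = 0 := by rw [← hwL, hv, dotProduct_zero]
    have hharm : M *ᵥ v = v := by
      have h : v - M *ᵥ v + (w ⬝ᵥ v) • (1 : m → ℝ) = 0 := hv
      rw [hwv, zero_smul, add_zero, sub_eq_zero] at h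
      exact h.symm
    ext i
    have hconst : v = v i • (1 : m → ℝ) := by
      ext j
      simpa using eq_of_mulVec_eq_self_of_irreducible hM hirr hharm j i
    rw [hconst, dotProduct_smul, hw1] at hwv
    simpa using hwv
  obtain ⟨u, hu⟩ := LinearMap.injective_iff_surjective.1 hinj c
  refine ⟨u, ?_⟩
  rw [← hu, hwL]
  exact (add_sub_cancel_right _ _).symm

/-- Abelian limit of the resolvent of an irreducible row stochastic matrix. -/
theorem tendsto_resolvent_of_irreducible {m : Type*} [Fintype m] [DecidableEq m]
    {M : Matrix m m ℝ} (hM : M ∈ rowStochastic ℝ m) (hirr : IsIrreducibleMat M)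
    {w : m → ℝ} (hw : w ᵥ* M = w) (hw1 : w ⬝ᵥ 1 = 1) (c : m → ℝ) (s : ℝ → m → ℝ)
    (hs : ∀ b ∈ Set.Ico (0 : ℝ) 1, s b - b • (M *ᵥ s b) = c) :
    Tendsto (fun b : ℝ => (1 - b) • s b) (nhdsWithin 1 (Set.Ico 0 1))
      (nhds ((w ⬝ᵥ c) • (1 : m → ℝ))) := by
  obtain ⟨u, hu⟩ := exists_sub_mulVec_eq_of_irreducible hM hirr hw hw1 c
  have hbound : ∀ b ∈ Set.Ico (0 : ℝ) 1,
      ‖(1 - b) • s b - (w ⬝ᵥ c) • (1 : m → ℝ)‖ ≤ (1 - b) * (‖u‖ + ‖u‖) := by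
    intro b hb
    have hb1 : 0 < 1 - b := sub_pos.2 hb.2
    set a := w ⬝ᵥ c
    set v := s b - (a / (1 - b)) • (1 : m → ℝ) - u with hv
    have hsplit : (1 - b) • s b - a • (1 : m → ℝ) = (1 - b) • (u + v) := by
      ext i
      simp only [hv, Pi.sub_apply, Pi.add_apply, Pi.smul_apply, smul_eq_mul, Pi.one_apply]
      field_simp
      ring
    have hveq : v = b • (M *ᵥ v) - (1 - b) • (M *ᵥ u) := by
      have hMv : M *ᵥ v = M *ᵥ s b - (a / (1 - b)) • (1 : m → ℝ) - M *ᵥ u := by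
        rw [hv, mulVec_sub, mulVec_sub, mulVec_smul, one_vecMul_of_mem_rowStochastic hM]
      rw [hMv]
      ext i
      have h1 := congrFun (hs b hb) i
      have h2 := congrFun hu i
      simp only [hv, Pi.sub_apply, Pi.smul_apply, smul_eq_mul, Pi.one_apply] at h1 h2 ⊢
      have h3 : a / (1 - b) * (1 - b) = a := div_mul_cancel₀ _ hb1.ne'
      linear_combination h1 - h2 - h3
    have hvle : ‖v‖ ≤ ‖u‖ := by
      have h : ‖v‖ ≤ b * ‖v‖ + (1 - b) * ‖u‖ :=
        calc ‖v‖ = ‖b • (M *ᵥ v) - (1 - b) • (M *ᵥ u)‖ := congrArg _ hveq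
          _ ≤ ‖b • (M *ᵥ v)‖ + ‖(1 - b) • (M *ᵥ u)‖ := norm_sub_le _ _
          _ = b * ‖M *ᵥ v‖ + (1 - b) * ‖M *ᵥ u‖ := by
            rw [norm_smul, norm_smul, Real.norm_of_nonneg hb.1, Real.norm_of_nonneg hb1.le]
          _ ≤ b * ‖v‖ + (1 - b) * ‖u‖ :=
            add_le_add
              (mul_le_mul_of_nonneg_left (norm_mulVec_le_of_mem_rowStochastic hM v) hb.1)
              (mul_le_mul_of_nonneg_left (norm_mulVec_le_of_mem_rowStochastic hM u) hb1.le)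
      nlinarith
    rw [hsplit, norm_smul, Real.norm_of_nonneg hb1.le]
    exact mul_le_mul_of_nonneg_left
      ((norm_add_le _ _).trans (add_le_add_right hvle _)) hb1.le
  rw [tendsto_iff_norm_sub_tendsto_zero]
  have hlim : Tendsto (fun b : ℝ => (1 - b) * (‖u‖ + ‖u‖)) (nhdsWithin 1 (Set.Ico 0 1))
      (nhds 0) := by
    have hc : Continuous fun b : ℝ => (1 - b) * (‖u‖ + ‖u‖) := by fun_prop
    simpa using (hc.tendsto 1).mono_left nhdsWithin_le_nhds
  exact squeeze_zero' (Eventually.of_forall fun _ => norm_nonneg _)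
    (eventually_nhdsWithin_of_forall hbound) hlim

theorem RowStochastic.mem_rowStochastic {n : ℕ} {P : Matrix (Fin n) (Fin n) ℝ}
    (hP : RowStochastic P) : P ∈ rowStochastic ℝ (Fin n) :=
  mem_rowStochastic_iff_sum.2 hP

theorem kronecker_self_mem_rowStochastic {m : Type*} [Fintype m] [DecidableEq m]
    {P : Matrix m m ℝ} (hP : P ∈ rowStochastic ℝ m) :
    P ⊗ₖ P ∈ rowStochastic ℝ (m × m) := by
  refine mem_rowStochastic_iff_sum.2 ⟨fun i j => ?_, fun i => ?_⟩
  · exact mul_nonneg (nonneg_of_mem_rowStochastic hP) (nonneg_of_mem_rowStochastic hP)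
  · simp only [kroneckerMap_apply, Fintype.sum_prod_type, ← Finset.mul_sum,
      sum_row_of_mem_rowStochastic hP, mul_one]

/-- Theorem (limiting behavior): let `P, Q` be row stochastic with
`M = (P⊗P + Q⊗Q)/2` irreducible, let `W` be the entrywise positive solution of
`(1/2)(Pᵀ W P + Qᵀ W Q) = W` normalized by `Σ_{i,j} W_{ij} = 1`, and for
`0 ≤ b = β² < 1` let `S(β)` solve `S − (β²/2)(P S Pᵀ + Q S Qᵀ) = PPᵀ + QQᵀ`.
Then `(1 − β²) S(β) → 2 trace(W) 𝟏𝟏ᵀ` as `β² → 1⁻`. -/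
theorem limiting_behavior {n : ℕ} (P Q W : Matrix (Fin n) (Fin n) ℝ)
    (hP : RowStochastic P) (hQ : RowStochastic Q)
    (hirr : IsIrreducibleMat ((1 / 2 : ℝ) • (P ⊗ₖ P + Q ⊗ₖ Q)))
    (hWpos : ∀ i j, 0 < W i j)
    (hWeq : (1 / 2 : ℝ) • (Pᵀ * W * P + Qᵀ * W * Q) = W)
    (hWsum : ∑ i, ∑ j, W i j = 1)
    (S : ℝ → Matrix (Fin n) (Fin n) ℝ)
    (hS : ∀ b ∈ Set.Ico (0 : ℝ) 1,
      S b - (b / 2) • (P * S b * Pᵀ + Q * S b * Qᵀ) = P * Pᵀ + Q * Qᵀ) :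
    Tendsto (fun b : ℝ => (1 - b) • S b) (nhdsWithin 1 (Set.Ico 0 1))
      (nhds ((2 * W.trace) • Matrix.of fun _ _ => (1 : ℝ))) := by
  set M := (1 / 2 : ℝ) • (P ⊗ₖ P + Q ⊗ₖ Q) with hMdef
  have hM : M ∈ rowStochastic ℝ (Fin n × Fin n) := by
    rw [hMdef, smul_add]
    exact convex_rowStochastic (kronecker_self_mem_rowStochastic hP.mem_rowStochastic)
      (kronecker_self_mem_rowStochastic hQ.mem_rowStochastic)
      (by norm_num) (by norm_num) (by norm_num)
  have hMvec : ∀ X : Matrix (Fin n) (Fin n) ℝ,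
      M *ᵥ vec X = vec ((1 / 2 : ℝ) • (P * X * Pᵀ + Q * X * Qᵀ)) := fun X => by
    rw [hMdef, smul_mulVec, add_mulVec, kronecker_mulVec_vec, kronecker_mulVec_vec,
      vec_smul, vec_add]
  have hw : vec W ᵥ* M = vec W := by
    rw [hMdef, vecMul_smul, vecMul_add, vec_vecMul_kronecker, vec_vecMul_kronecker,
      ← vec_add, ← vec_smul, hWeq]
  have hw1 : vec W ⬝ᵥ 1 = 1 := by
    rw [dotProduct_one, Fintype.sum_prod_type, Finset.sum_comm]
    exact hWsum
  have hs : ∀ b ∈ Set.Ico (0 : ℝ) 1,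
      vec (S b) - b • (M *ᵥ vec (S b)) = vec (P * Pᵀ + Q * Qᵀ) := fun b hb => by
    rw [← hS b hb, hMvec, ← vec_smul, ← vec_sub, smul_smul, mul_one_div]
  have hwc : vec W ⬝ᵥ vec (P * Pᵀ + Q * Qᵀ) = 2 * W.trace := by
    have htr : ∀ R : Matrix (Fin n) (Fin n) ℝ,
        trace (Wᵀ * (R * Rᵀ)) = trace (Rᵀ * W * R) := fun R => by
      rw [← trace_transpose, transpose_mul, transpose_mul, transpose_transpose,
        transpose_transpose, Matrix.mul_assoc, trace_mul_comm]
    have h := congrArg trace hWeq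
    rw [trace_smul, trace_add, smul_eq_mul] at h
    rw [vec_dotProduct_vec, Matrix.mul_add, trace_add, htr, htr]
    linarith
  have hlim := tendsto_resolvent_of_irreducible hM hirr hw hw1 _ (fun b => vec (S b)) hs
  rw [hwc] at hlim
  refine tendsto_pi_nhds.2 fun i => tendsto_pi_nhds.2 fun j => ?_
  exact tendsto_pi_nhds.1 hlim (j, i)
end

section
/- Consider a degree-corrected stochastic block model: a partition of {1,…,n} into r nonempty blocks of sizes n₁,…,n_r with normalized membership matrix Θ ∈ ℝ^{n×r} (the i-th column of Θ equals (1/√n_i)·χ^(i), where χ^(i) is the characteristic vector of block i); a matrix B ∈ ℝ^{r×r} with nonnegative entries and no zero row or column; and diagonal matrices D₁, D₂ with positive diagonal entries. Let A = D₁ Θ B Θᵀ D₂, and let P = D_out^{−1}A and Q = D_in^{−1}Aᵀ be the row-stochastic normalizations of A and Aᵀ (D_out, D_in the diagonal matrices of row sums of A, Aᵀ). Set M = Θᵀ P Θ and N = Θᵀ Q Θ. If 0 ≤ β² < 1, then the matrix equation X − (β²/2)(M X Mᵀ + N X Nᵀ) = Θᵀ(PPᵀ + QQᵀ)Θ has a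 unique solution X ∈ ℝ^{r×r}, and this solution is symmetric positive semidefinite. -/
open Matrix

/-- Size of the `p`-th block of the partition of `{1,…,n}` induced by the
block-assignment map `blk`. -/
def blockSize {n r : ℕ} (blk : Fin n → Fin r) (p : Fin r) : ℕ :=
  (Finset.univ.filter fun i => blk i = p).card

/-- Normalized membership matrix `Θ ∈ ℝ^{n×r}`: the `p`-th column is
`(1/√n_p)·χ^(p)`, where `χ^(p)` is the characteristic vector of block `p`
and `n_p` its size. Its columns are orthonormal. -/
noncomputable def Theta {n r : ℕ} (blk : Fin n → Fin r) :
    Matrix (Fin n) (Fin r) ℝ :=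
  Matrix.of fun i p =>
    if blk i = p then (Real.sqrt (blockSize blk p))⁻¹ else 0

/-- If `M` is nonnegative and fixes `s`, then an entrywise bound of `X` by `c s sᵀ` is inherited by
`M X Mᵀ`. -/
theorem abs_congruence_le {ι : Type*} [Fintype ι] {M : Matrix ι ι ℝ} {s : ι → ℝ}
    (hM : ∀ p q, 0 ≤ M p q) (hMs : M *ᵥ s = s) {X : Matrix ι ι ℝ} {c : ℝ}
    (hX : ∀ p q, |X p q| ≤ c * (s p * s q)) (p q : ι) :
    |(M * X * Mᵀ) p q| ≤ c * (s p * s q) := by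
  have hs : ∀ p, ∑ a, M p a * s a = s p := fun p => congrFun hMs p
  have key : c * (s p * s q) = ∑ b, (∑ a, M p a * (c * (s a * s b))) * M q b := by
    rw [← hs p, ← hs q, Finset.sum_mul_sum, Finset.sum_comm, Finset.mul_sum]
    refine Finset.sum_congr rfl fun b _ => ?_
    rw [Finset.mul_sum, Finset.sum_mul]
    exact Finset.sum_congr rfl fun a _ => by ring
  rw [key, Matrix.mul_apply]
  refine (Finset.abs_sum_le_sum_abs _ _).trans (Finset.sum_le_sum fun b _ => ?_)
  rw [abs_mul, Matrix.transpose_apply, abs_of_nonneg (hM q b), Matrix.mul_apply]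
  refine mul_le_mul_of_nonneg_right ?_ (hM q b)
  refine (Finset.abs_sum_le_sum_abs _ _).trans (Finset.sum_le_sum fun a _ => ?_)
  rw [abs_mul, abs_of_nonneg (hM p a)]
  exact mul_le_mul_of_nonneg_left (hX a b) (hM p a)

/-- The linear operator `X ↦ b (M X Mᵀ + N X Nᵀ)` on square matrices. -/
noncomputable def steinOperator {ι : Type*} [Fintype ι] (M N : Matrix ι ι ℝ) (b : ℝ) :
    Matrix ι ι ℝ →ₗ[ℝ] Matrix ι ι ℝ where
  toFun X := b • (M * X * Mᵀ + N * X * Nᵀ)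
  map_add' X Y := by
    simp only [Matrix.mul_add, Matrix.add_mul, smul_add]
    abel
  map_smul' t X := by
    simp only [Matrix.mul_smul, Matrix.smul_mul, RingHom.id_apply, ← smul_add]
    rw [smul_comm]

theorem steinOperator_apply {ι : Type*} [Fintype ι] (M N : Matrix ι ι ℝ) (b : ℝ)
    (X : Matrix ι ι ℝ) : steinOperator M N b X = b • (M * X * Mᵀ + N * X * Nᵀ) := rfl

theorem transpose_steinOperator {ι : Type*} [Fintype ι] (M N : Matrix ι ι ℝ) (b : ℝ)
    (X : Matrix ι ι ℝ) : (steinOperator M N b X)ᵀ = steinOperator M N b Xᵀ := by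
  simp [steinOperator_apply, Matrix.transpose_mul, Matrix.mul_assoc]

theorem Matrix.PosSemidef.steinOperator {ι : Type*} [Fintype ι] (M N : Matrix ι ι ℝ) {b : ℝ}
    (hb : 0 ≤ b) {X : Matrix ι ι ℝ} (hX : X.PosSemidef) : (steinOperator M N b X).PosSemidef := by
  have hM := hX.mul_mul_conjTranspose_same M
  have hN := hX.mul_mul_conjTranspose_same N
  rw [Matrix.conjTranspose_eq_transpose_of_trivial] at hM hN
  exact (hM.add hN).smul hb

section SteinOperator

variable {ι : Type*} [Fintype ι] {M N : Matrix ι ι ℝ} {s : ι → ℝ} {b : ℝ}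

theorem abs_steinOperator_le (hM : ∀ p q, 0 ≤ M p q) (hN : ∀ p q, 0 ≤ N p q)
    (hMs : M *ᵥ s = s) (hNs : N *ᵥ s = s) (hb : 0 ≤ b) {X : Matrix ι ι ℝ} {c : ℝ}
    (hX : ∀ p q, |X p q| ≤ c * (s p * s q)) (p q : ι) :
    |steinOperator M N b X p q| ≤ 2 * b * c * (s p * s q) := by
  rw [steinOperator_apply, Matrix.smul_apply, Matrix.add_apply, smul_eq_mul, abs_mul,
    abs_of_nonneg hb]
  have h := (abs_add_le ((M * X * Mᵀ) p q) ((N * X * Nᵀ) p q)).trans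
    (add_le_add (abs_congruence_le hM hMs hX p q) (abs_congruence_le hN hNs hX p q))
  calc _ ≤ b * (c * (s p * s q) + c * (s p * s q)) := mul_le_mul_of_nonneg_left h hb
    _ = _ := by ring

open Filter Topology in
theorem tendsto_steinOperator_pow (hM : ∀ p q, 0 ≤ M p q) (hN : ∀ p q, 0 ≤ N p q)
    (hs : ∀ p, 0 < s p) (hMs : M *ᵥ s = s) (hNs : N *ᵥ s = s) (hb : 0 ≤ b) (hb1 : 2 * b < 1)
    (X : Matrix ι ι ℝ) :
    Tendsto (fun k : ℕ => (steinOperator M N b ^ k) X) atTop (𝓝 0) := by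
  have hX : ∀ p q, |X p q| ≤ (∑ a, ∑ b, |X a b| / (s a * s b)) * (s p * s q) := by
    intro p q
    have hpos : ∀ a b, 0 ≤ |X a b| / (s a * s b) := fun a b =>
      div_nonneg (abs_nonneg _) (mul_pos (hs a) (hs b)).le
    rw [← div_le_iff₀ (mul_pos (hs p) (hs q))]
    calc |X p q| / (s p * s q) ≤ ∑ b, |X p b| / (s p * s b) :=
          Finset.single_le_sum (f := fun b => |X p b| / (s p * s b))
            (fun b _ => hpos p b) (Finset.mem_univ q)
      _ ≤ _ := Finset.single_le_sum (f := fun a => ∑ b, |X a b| / (s a * s b))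
            (fun a _ => Finset.sum_nonneg fun b _ => hpos a b) (Finset.mem_univ p)
  generalize (∑ a, ∑ b, |X a b| / (s a * s b)) = c at hX
  have hbound : ∀ k p q,
      |(steinOperator M N b ^ k) X p q| ≤ (2 * b) ^ k * c * (s p * s q) := by
    intro k
    induction k with
    | zero => simpa using hX
    | succ k ih =>
      intro p q
      rw [pow_succ', Module.End.mul_apply]
      refine (abs_steinOperator_le hM hN hMs hNs hb ih p q).trans_eq ?_
      ring
  refine tendsto_pi_nhds.2 fun p => tendsto_pi_nhds.2 fun q => ?_
  refine squeeze_zero_norm (fun k => hbound k p q) ?_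
  have h := tendsto_pow_atTop_nhds_zero_of_lt_one (by linarith : 0 ≤ 2 * b) hb1
  simpa using (h.mul_const c).mul_const (s p * s q)

theorem injective_id_sub_steinOperator (hM : ∀ p q, 0 ≤ M p q) (hN : ∀ p q, 0 ≤ N p q)
    (hs : ∀ p, 0 < s p) (hMs : M *ᵥ s = s) (hNs : N *ᵥ s = s) (hb : 0 ≤ b) (hb1 : 2 * b < 1) :
    Function.Injective
      ((LinearMap.id : Matrix ι ι ℝ →ₗ[ℝ] Matrix ι ι ℝ) - steinOperator M N b) := by
  refine (injective_iff_map_eq_zero _).2 fun X hX => ?_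
  have hfix : steinOperator M N b X = X := by
    simpa using (sub_eq_zero.1 hX).symm
  have hpow : ∀ k : ℕ, (steinOperator M N b ^ k) X = X := by
    intro k
    induction k with
    | zero => simp
    | succ k ih => rw [pow_succ', Module.End.mul_apply, ih, hfix]
  have h := tendsto_steinOperator_pow hM hN hs hMs hNs hb hb1 X
  simp only [hpow] at h
  exact tendsto_nhds_unique tendsto_const_nhds h

theorem isSymm_of_sub_steinOperator_eq (hM : ∀ p q, 0 ≤ M p q) (hN : ∀ p q, 0 ≤ N p q)
    (hs : ∀ p, 0 < s p) (hMs : M *ᵥ s = s) (hNs : N *ᵥ s = s) (hb : 0 ≤ b) (hb1 : 2 * b < 1)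
    {X F : Matrix ι ι ℝ} (hF : F.IsSymm) (hX : X - steinOperator M N b X = F) : X.IsSymm := by
  refine injective_id_sub_steinOperator hM hN hs hMs hNs hb hb1 ?_
  simp only [LinearMap.sub_apply, LinearMap.id_apply]
  rw [hX, ← transpose_steinOperator, ← Matrix.transpose_sub, hX, hF.eq]

open Filter Topology in
theorem posSemidef_of_sub_steinOperator_eq (hM : ∀ p q, 0 ≤ M p q) (hN : ∀ p q, 0 ≤ N p q)
    (hs : ∀ p, 0 < s p) (hMs : M *ᵥ s = s) (hNs : N *ᵥ s = s) (hb : 0 ≤ b) (hb1 : 2 * b < 1)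
    {X F : Matrix ι ι ℝ} (hF : F.PosSemidef) (hX : X - steinOperator M N b X = F) :
    X.PosSemidef := by
  have hsymm : X.IsSymm :=
    isSymm_of_sub_steinOperator_eq hM hN hs hMs hNs hb hb1
      (by simpa [Matrix.IsHermitian, Matrix.IsSymm] using hF.isHermitian) hX
  have hpartial : ∀ k : ℕ, (X - (steinOperator M N b ^ k) X).PosSemidef := by
    intro k
    induction k with
    | zero => simpa using Matrix.PosSemidef.zero
    | succ k ih =>
      have h := hF.add (ih.steinOperator M N hb)
      rw [map_sub, ← hX, sub_add_sub_cancel] at h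
      rwa [pow_succ', Module.End.mul_apply]
  have hlim : Tendsto (fun k : ℕ => X - (steinOperator M N b ^ k) X) atTop (𝓝 X) := by
    simpa using (tendsto_const_nhds (x := X)).sub
      (tendsto_steinOperator_pow hM hN hs hMs hNs hb hb1 X)
  refine Matrix.PosSemidef.of_dotProduct_mulVec_nonneg
    (by simpa [Matrix.IsHermitian] using hsymm.eq) fun v => ?_
  have hcont : Continuous fun Y : Matrix ι ι ℝ => star v ⬝ᵥ (Y *ᵥ v) := by fun_prop
  exact ge_of_tendsto' ((hcont.tendsto X).comp hlim)
    fun k => (hpartial k).dotProduct_mulVec_nonneg v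

end SteinOperator

section RowNormalize

variable {n : ℕ} {A : Matrix (Fin n) (Fin n) ℝ}

theorem rowNormalize_nonneg (hA : ∀ i j, 0 ≤ A i j) (i j : Fin n) : 0 ≤ rowNormalize A i j := by
  rw [rowNormalize, Matrix.diagonal_mul]
  exact mul_nonneg (inv_nonneg.2 (Finset.sum_nonneg fun k _ => hA i k)) (hA i j)

theorem rowNormalize_mulVec_one (hA : ∀ i j, 0 ≤ A i j) (hpos : ∀ i, ∃ j, 0 < A i j) :
    rowNormalize A *ᵥ 1 = 1 := by
  ext i
  obtain ⟨j, hj⟩ := hpos i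
  have hsum : 0 < ∑ k, A i k :=
    Finset.sum_pos' (fun k _ => hA i k) ⟨j, Finset.mem_univ j, hj⟩
  simp only [rowNormalize, Matrix.mulVec, dotProduct, Matrix.diagonal_mul, Pi.one_apply, mul_one,
    ← Finset.mul_sum]
  exact inv_mul_cancel₀ hsum.ne'

end RowNormalize

section Theta

variable {n r : ℕ} {blk : Fin n → Fin r}

theorem blockSize_apply_pos (blk : Fin n → Fin r) (i : Fin n) : 0 < blockSize blk (blk i) :=
  Finset.card_pos.2 ⟨i, by simp⟩

theorem Theta_nonneg (i : Fin n) (p : Fin r) : 0 ≤ Theta blk i p := by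
  rw [Theta, Matrix.of_apply]
  split_ifs <;> positivity

theorem Theta_mulVec_sqrt : Theta blk *ᵥ (fun p => √(blockSize blk p)) = 1 := by
  ext i
  have h : (0 : ℝ) < √(blockSize blk (blk i)) :=
    Real.sqrt_pos.2 (Nat.cast_pos.2 (blockSize_apply_pos blk i))
  simp [Matrix.mulVec, dotProduct, Theta, ite_mul, h.ne']

theorem Theta_transpose_mulVec_one : (Theta blk)ᵀ *ᵥ 1 = fun p => √(blockSize blk p) := by
  ext p
  simp only [Matrix.mulVec, dotProduct, Pi.one_apply, mul_one, Matrix.transpose_apply, Theta,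
    Matrix.of_apply, ← Finset.sum_filter, Finset.sum_const, nsmul_eq_mul]
  exact Real.div_sqrt

theorem compress_mulVec_sqrt {P : Matrix (Fin n) (Fin n) ℝ} (hP : P *ᵥ 1 = 1) :
    ((Theta blk)ᵀ * P * Theta blk) *ᵥ (fun p => √(blockSize blk p)) =
      fun p => √(blockSize blk p) := by
  rw [← Matrix.mulVec_mulVec, Theta_mulVec_sqrt, ← Matrix.mulVec_mulVec, hP,
    Theta_transpose_mulVec_one]

theorem compress_nonneg {P : Matrix (Fin n) (Fin n) ℝ} (hP : ∀ i j, 0 ≤ P i j) (p q : Fin r) :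
    0 ≤ ((Theta blk)ᵀ * P * Theta blk) p q := by
  simp only [Matrix.mul_apply, Matrix.transpose_apply]
  exact Finset.sum_nonneg fun j _ => mul_nonneg
    (Finset.sum_nonneg fun i _ => mul_nonneg (Theta_nonneg i p) (hP i j)) (Theta_nonneg j q)

theorem blockModel_apply (B : Matrix (Fin r) (Fin r) ℝ) (d₁ d₂ : Fin n → ℝ) (i j : Fin n) :
    (Matrix.diagonal d₁ * (Theta blk * B * (Theta blk)ᵀ) * Matrix.diagonal d₂) i j =
      d₁ i * ((√(blockSize blk (blk i)))⁻¹ * B (blk i) (blk j) *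
        (√(blockSize blk (blk j)))⁻¹) * d₂ j := by
  rw [Matrix.mul_diagonal, Matrix.diagonal_mul]
  simp [Matrix.mul_apply, Theta]

theorem blockModel_nonneg {B : Matrix (Fin r) (Fin r) ℝ} (hB : ∀ p q, 0 ≤ B p q)
    {d₁ d₂ : Fin n → ℝ} (hd₁ : ∀ i, 0 < d₁ i) (hd₂ : ∀ i, 0 < d₂ i) (i j : Fin n) :
    0 ≤ (Matrix.diagonal d₁ * (Theta blk * B * (Theta blk)ᵀ) * Matrix.diagonal d₂) i j := by
  rw [blockModel_apply]
  have := hB (blk i) (blk j)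
  have := hd₁ i
  have := hd₂ j
  positivity

theorem exists_blockModel_pos (hblk : Function.Surjective blk) {B : Matrix (Fin r) (Fin r) ℝ}
    (hB : ∀ p, ∃ q, 0 < B p q)
    {d₁ d₂ : Fin n → ℝ} (hd₁ : ∀ i, 0 < d₁ i) (hd₂ : ∀ i, 0 < d₂ i) (i : Fin n) :
    ∃ j, 0 < (Matrix.diagonal d₁ * (Theta blk * B * (Theta blk)ᵀ) * Matrix.diagonal d₂) i j := by
  obtain ⟨q, hq⟩ := hB (blk i)
  obtain ⟨j, rfl⟩ := hblk q
  refine ⟨j, ?_⟩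
  rw [blockModel_apply]
  have := hd₁ i
  have := hd₂ j
  have := blockSize_apply_pos blk i
  have := blockSize_apply_pos blk j
  positivity

end Theta

/-- Theorem (Lemma on the reduced equation): in the degree-corrected SBM
setting `A = D₁ Θ B Θᵀ D₂` (with `blk` surjective, `B` nonnegative with no
zero row or column, `D₁, D₂` positive diagonal), `P, Q` the row-stochastic
normalizations of `A, Aᵀ`, `M = Θᵀ P Θ`, `N = Θᵀ Q Θ`, and `0 ≤ β² < 1`, the
equation `X − (β²/2)(M X Mᵀ + N X Nᵀ) = Θᵀ(PPᵀ + QQᵀ)Θ` has a unique solution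
`X ∈ ℝ^{r×r}`, and this solution is symmetric positive semidefinite. -/
theorem reduced_equation_unique_posSemidef {n r : ℕ}
    (blk : Fin n → Fin r) (hblk : Function.Surjective blk)
    (B : Matrix (Fin r) (Fin r) ℝ)
    (hBnn : ∀ p q, 0 ≤ B p q)
    (hBrow : ∀ p, ∃ q, 0 < B p q) (hBcol : ∀ q, ∃ p, 0 < B p q)
    (d₁ d₂ : Fin n → ℝ) (hd₁ : ∀ i, 0 < d₁ i) (hd₂ : ∀ i, 0 < d₂ i)
    (A P Q : Matrix (Fin n) (Fin n) ℝ)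
    (hA : A = Matrix.diagonal d₁ * (Theta blk * B * (Theta blk)ᵀ) *
      Matrix.diagonal d₂)
    (hP : P = rowNormalize A) (hQ : Q = rowNormalize Aᵀ)
    (M N : Matrix (Fin r) (Fin r) ℝ)
    (hM : M = (Theta blk)ᵀ * P * Theta blk)
    (hN : N = (Theta blk)ᵀ * Q * Theta blk)
    (β : ℝ) (hβ : β ^ 2 < 1) :
    (∃! X : Matrix (Fin r) (Fin r) ℝ,
      X - (β ^ 2 / 2) • (M * X * Mᵀ + N * X * Nᵀ) =
        (Theta blk)ᵀ * (P * Pᵀ + Q * Qᵀ) * Theta blk) ∧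
    ∀ X : Matrix (Fin r) (Fin r) ℝ,
      X - (β ^ 2 / 2) • (M * X * Mᵀ + N * X * Nᵀ) =
        (Theta blk)ᵀ * (P * Pᵀ + Q * Qᵀ) * Theta blk →
      X.IsSymm ∧ X.PosSemidef := by
  have hAT : Aᵀ = Matrix.diagonal d₂ * (Theta blk * Bᵀ * (Theta blk)ᵀ) * Matrix.diagonal d₁ := by
    simp [hA, Matrix.transpose_mul, Matrix.mul_assoc]
  have hAnn : ∀ i j, 0 ≤ A i j := hA ▸ blockModel_nonneg hBnn hd₁ hd₂
  have hPnn : ∀ i j, 0 ≤ P i j := hP ▸ rowNormalize_nonneg hAnn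
  have hQnn : ∀ i j, 0 ≤ Q i j := hQ ▸ rowNormalize_nonneg fun i j => hAnn j i
  have hP1 : P *ᵥ 1 = 1 :=
    hP ▸ rowNormalize_mulVec_one hAnn (hA ▸ exists_blockModel_pos hblk hBrow hd₁ hd₂)
  have hQ1 : Q *ᵥ 1 = 1 :=
    hQ ▸ rowNormalize_mulVec_one (fun i j => hAnn j i)
      (hAT ▸ exists_blockModel_pos (B := Bᵀ) hblk hBcol hd₂ hd₁)
  have hMnn : ∀ p q, 0 ≤ M p q := hM ▸ compress_nonneg hPnn
  have hNnn : ∀ p q, 0 ≤ N p q := hN ▸ compress_nonneg hQnn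
  have hMs : M *ᵥ (fun p => √(blockSize blk p)) = _ := hM ▸ compress_mulVec_sqrt hP1
  have hNs : N *ᵥ (fun p => √(blockSize blk p)) = _ := hN ▸ compress_mulVec_sqrt hQ1
  have hs : ∀ p, 0 < √(blockSize blk p : ℝ) := fun p => by
    obtain ⟨i, rfl⟩ := hblk p
    exact Real.sqrt_pos.2 (Nat.cast_pos.2 (blockSize_apply_pos blk i))
  have hb : 0 ≤ β ^ 2 / 2 := by positivity
  have hb1 : 2 * (β ^ 2 / 2) < 1 := by linarith
  have hF : ((Theta blk)ᵀ * (P * Pᵀ + Q * Qᵀ) * Theta blk).PosSemidef := by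
    have h := (Matrix.posSemidef_self_mul_conjTranspose P).add
      (Matrix.posSemidef_self_mul_conjTranspose Q)
    simpa only [Matrix.conjTranspose_eq_transpose_of_trivial] using
      h.conjTranspose_mul_mul_same (Theta blk)
  have hinj := injective_id_sub_steinOperator hMnn hNnn hs hMs hNs hb hb1
  refine ⟨?_, fun X hX => ?_⟩
  · obtain ⟨X, hX⟩ := LinearMap.surjective_of_injective hinj
      ((Theta blk)ᵀ * (P * Pᵀ + Q * Qᵀ) * Theta blk)
    exact ⟨X, hX, fun Y hY => hinj (Eq.trans hY hX.symm)⟩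
  · have hX' := posSemidef_of_sub_steinOperator_eq hMnn hNnn hs hMs hNs hb hb1 hF hX
    exact ⟨by simpa [Matrix.IsHermitian, Matrix.IsSymm] using hX'.isHermitian, hX'⟩
end

section
/- In the degree-corrected stochastic block model setting (Θ ∈ ℝ^{n×r} a normalized membership matrix, B ∈ ℝ^{r×r} nonnegative with no zero row or column, D₁, D₂ positive diagonal, A = D₁ Θ B Θᵀ D₂, and P, Q the row-stochastic normalizations of A and Aᵀ), the column spaces of P and Q are contained in the column space of Θ; equivalently, P = Θ Θᵀ P and Q = Θ Θᵀ Q. -/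
open Matrix

/-- Multiplying by `Θ` on the left selects, and rescales, the row of the block. -/
lemma Theta_mul_apply {n r : ℕ} {m : Type*} (blk : Fin n → Fin r)
    (C : Matrix (Fin r) m ℝ) (i : Fin n) (j : m) :
    (Theta blk * C) i j = (Real.sqrt (blockSize blk (blk i)))⁻¹ * C (blk i) j := by
  simp [Theta, Matrix.mul_apply, ite_mul]

/-- The projector `Θ Θᵀ` fixes every matrix whose rows are constant on blocks. -/
lemma Theta_mul_transpose_mul_of_const {n r : ℕ} {m : Type*} (blk : Fin n → Fin r)
    (M : Matrix (Fin n) m ℝ) (hM : ∀ i k, blk i = blk k → M i = M k) :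
    Theta blk * (Theta blk)ᵀ * M = M := by
  ext i j
  have hsum : ((Theta blk)ᵀ * M) (blk i) j =
      blockSize blk (blk i) * ((Real.sqrt (blockSize blk (blk i)))⁻¹ * M i j) := by
    have hterm : ∀ k, (Theta blk)ᵀ (blk i) k * M k j =
        if blk k = blk i then (Real.sqrt (blockSize blk (blk i)))⁻¹ * M i j else 0 := by
      intro k
      by_cases h : blk k = blk i
      · simp [Theta, h, hM k i h]
      · simp [Theta, h]
    rw [Matrix.mul_apply, Finset.sum_congr rfl fun k _ => hterm k, ← Finset.sum_filter,
      Finset.sum_const, nsmul_eq_mul, blockSize]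
  have hpos : (0 : ℝ) < blockSize blk (blk i) := by
    have : 0 < blockSize blk (blk i) := Finset.card_pos.mpr ⟨i, by simp⟩
    exact_mod_cast this
  rw [Matrix.mul_assoc, Theta_mul_apply, hsum]
  have hsqrt := Real.sq_sqrt hpos.le
  have hne := (Real.sqrt_pos.mpr hpos).ne'
  field_simp
  rw [hsqrt]

/-- Row normalization removes row scalings, so that the rows of the normalization of
`D Θ C` are constant on blocks. -/
lemma rowNormalize_diagonal_mul_Theta_mul_const {n r : ℕ} (blk : Fin n → Fin r)
    (d : Fin n → ℝ) (hd : ∀ i, d i ≠ 0) (C : Matrix (Fin r) (Fin n) ℝ)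
    (i k : Fin n) (hik : blk i = blk k) :
    rowNormalize (Matrix.diagonal d * (Theta blk * C)) i =
      rowNormalize (Matrix.diagonal d * (Theta blk * C)) k := by
  have key : ∀ i j, rowNormalize (Matrix.diagonal d * (Theta blk * C)) i j =
      (∑ l, (Theta blk * C) i l)⁻¹ * (Theta blk * C) i j := by
    intro i j
    simp only [rowNormalize, Matrix.diagonal_mul, ← Finset.mul_sum, mul_inv]
    have := hd i
    field_simp
  ext j
  simp only [key, Theta_mul_apply, hik]

/-- Theorem: in the degree-corrected SBM setting, the column spaces of `P` and
`Q` are contained in the column space of `Θ`; equivalently, `P = Θ Θᵀ P` and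
`Q = Θ Θᵀ Q` (where `Θ Θᵀ` is the orthogonal projector onto the column span
of `Θ`). -/
theorem colSpace_in_Theta {n r : ℕ}
    (blk : Fin n → Fin r) (hblk : Function.Surjective blk)
    (B : Matrix (Fin r) (Fin r) ℝ)
    (hBnn : ∀ p q, 0 ≤ B p q)
    (hBrow : ∀ p, ∃ q, 0 < B p q) (hBcol : ∀ q, ∃ p, 0 < B p q)
    (d₁ d₂ : Fin n → ℝ) (hd₁ : ∀ i, 0 < d₁ i) (hd₂ : ∀ i, 0 < d₂ i)
    (A P Q : Matrix (Fin n) (Fin n) ℝ)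
    (hA : A = Matrix.diagonal d₁ * (Theta blk * B * (Theta blk)ᵀ) *
      Matrix.diagonal d₂)
    (hP : P = rowNormalize A) (hQ : Q = rowNormalize Aᵀ) :
    P = Theta blk * (Theta blk)ᵀ * P ∧ Q = Theta blk * (Theta blk)ᵀ * Q := by
  subst hP hQ
  constructor
  · have h : A = Matrix.diagonal d₁ * (Theta blk * (B * (Theta blk)ᵀ * Matrix.diagonal d₂)) := by
      simp only [hA, Matrix.mul_assoc]
    rw [h]
    exact (Theta_mul_transpose_mul_of_const blk _
      (rowNormalize_diagonal_mul_Theta_mul_const blk d₁ (fun i => (hd₁ i).ne') _)).symm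
  · have h : Aᵀ =
        Matrix.diagonal d₂ * (Theta blk * (Bᵀ * (Theta blk)ᵀ * Matrix.diagonal d₁)) := by
      simp only [hA, Matrix.transpose_mul, Matrix.transpose_transpose,
        Matrix.diagonal_transpose, Matrix.mul_assoc]
    rw [h]
    exact (Theta_mul_transpose_mul_of_const blk _
      (rowNormalize_diagonal_mul_Theta_mul_const blk d₂ (fun i => (hd₂ i).ne') _)).symm
end
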